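/- arXiv:1609.06019 — 4 statements merged into one kernel-verified Lean document; each statement's English description precedes it below -/
import Mathlib

section
/- Let r be a ground active integrity constraint with pos(r) ∩ neg(r) = ∅. Then r is valid in the following sense: (i) for every database DB' with DB' ⊭ r there exists α ∈ head(r) such that {α}(DB') ⊨ r; and (ii) for every α ∈ head(r) there exists a database DB' with DB' ⊭ r and {α}(DB') ⊨ r. (This is the content of the proposition that every AIC over a database DB yields a valid AIC over the multi-context system M(DB), expressed directly in database terms.) -/
namespace AICs

/-- An update action: add an atom or delete an atom. -/
inductive Act (A : Type*) where
  | add : A → Act A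
  | del : A → Act A

/-- A set of update actions is consistent if it does not contain
both `+a` and `-a` for any atom `a`. -/
def Consistent {A : Type*} (U : Set (Act A)) : Prop :=
  ∀ a : A, ¬ (Act.add a ∈ U ∧ Act.del a ∈ U)

/-- Applying a set of update actions to a database:
`U(DB) = (DB ∪ {a | +a ∈ U}) \ {a | -a ∈ U}`. -/
def applyUpd {A : Type*} (U : Set (Act A)) (DB : Set A) : Set A :=
  (DB ∪ {a | Act.add a ∈ U}) \ {a | Act.del a ∈ U}

/-- A ground active integrity constraint. -/
structure AIC (A : Type*) where
  pos : Set A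
  neg : Set A
  head : Set (Act A)
  pos_finite : pos.Finite
  neg_finite : neg.Finite
  head_finite : head.Finite
  head_nonempty : head.Nonempty
  head_sound : ∀ α ∈ head,
    (∃ a ∈ pos, α = Act.del a) ∨ (∃ a ∈ neg, α = Act.add a)

/-- `DB ⊨ r` iff it is not the case that `pos(r) ⊆ DB` and `neg(r) ∩ DB = ∅`. -/
def Sat {A : Type*} (DB : Set A) (r : AIC A) : Prop :=
  ¬ (r.pos ⊆ DB ∧ r.neg ∩ DB = ∅)

/-- `DB ⊨ η` iff `DB ⊨ r` for all `r ∈ η`. -/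
def SatSet {A : Type*} (DB : Set A) (η : Set (AIC A)) : Prop :=
  ∀ r ∈ η, Sat DB r

/-- A weak repair for `⟨DB, η⟩`. -/
def WeakRepair {A : Type*} (DB : Set A) (η : Set (AIC A)) (U : Set (Act A)) : Prop :=
  U.Finite ∧ Consistent U ∧
  (∀ a : A, Act.add a ∈ U → a ∉ DB) ∧
  (∀ a : A, Act.del a ∈ U → a ∈ DB) ∧
  SatSet (applyUpd U DB) η

/-- Groundedness: for every `V ⊊ U` there is `r ∈ η` with `V(DB) ⊭ r`
and `head(r) ∩ (U \ V) ≠ ∅`. -/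
def Grounded {A : Type*} (DB : Set A) (η : Set (AIC A)) (U : Set (Act A)) : Prop :=
  ∀ V : Set (Act A), V ⊂ U →
    ∃ r ∈ η, ¬ Sat (applyUpd V DB) r ∧ (r.head ∩ (U \ V)).Nonempty

/-- The child relation of the repair tree `T⟨DB,η⟩`. -/
def Child {A : Type*} (DB : Set A) (η : Set (AIC A)) (n n' : Set (Act A)) : Prop :=
  Consistent n ∧ ∃ r ∈ η, ∃ U ⊆ r.head,
    ¬ Sat (applyUpd n DB) r ∧ n' = n ∪ U ∧ Consistent n' ∧
    Sat (applyUpd n' DB) r ∧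
    ∀ U' : Set (Act A), U' ⊂ U → ¬ Sat (applyUpd (n ∪ U') DB) r

/-- The nodes of the repair tree: sets reachable from the root `∅`
via the child relation. -/
def Node {A : Type*} (DB : Set A) (η : Set (AIC A)) (n : Set (Act A)) : Prop :=
  Relation.ReflTransGen (Child DB η) ∅ n

end AICs

namespace AICs
/-- After any action of the head, the constraint is satisfied. -/
theorem AIC.sat_applyUpd_singleton {A : Type*} (r : AIC A) {α : Act A} (hα : α ∈ r.head)
    (DB : Set A) : Sat (applyUpd {α} DB) r := by
  rintro ⟨hpos, hneg⟩
  obtain ⟨a, ha, rfl⟩ | ⟨a, ha, rfl⟩ := r.head_sound α hα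
  · exact (hpos ha).2 rfl
  · have hmem : a ∈ r.neg ∩ applyUpd {Act.add a} DB := ⟨ha, Or.inr rfl, by simp⟩
    rw [hneg] at hmem
    exact hmem

/-- every ground AIC with `pos(r) ∩ neg(r) = ∅` is valid:
(i) every database violating `r` can be repaired by a single action from `head(r)`;
(ii) no action in `head(r)` is useless. -/
theorem stmt_1 {A : Type*} (r : AIC A) (hdisj : r.pos ∩ r.neg = ∅) :
    (∀ DB' : Set A, ¬ Sat DB' r → ∃ α ∈ r.head, Sat (applyUpd {α} DB') r) ∧
    (∀ α ∈ r.head, ∃ DB' : Set A, ¬ Sat DB' r ∧ Sat (applyUpd {α} DB') r) := by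
  refine ⟨fun DB' _ => ?_, fun α hα => ⟨r.pos, ?_, r.sat_applyUpd_singleton hα _⟩⟩
  · obtain ⟨α, hα⟩ := r.head_nonempty
    exact ⟨α, hα, r.sat_applyUpd_singleton hα DB'⟩
  · exact not_not_intro ⟨subset_rfl, Set.inter_comm r.pos r.neg ▸ hdisj⟩

end AICs
end

section
/- Let η be a finite set of ground AICs over a database DB. Then the repair tree T⟨DB,η⟩ is finite: it has finitely many nodes, and each node has only finitely many children. -/
namespace AICs
/-- the repair tree is finite: it has finitely many nodes,
and each node has finitely many children. -/
theorem stmt_5 {A : Type*} (DB : Set A) (η : Set (AIC A)) (hη : η.Finite) :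
    {n : Set (Act A) | Node DB η n}.Finite ∧
    ∀ n : Set (Act A), {n' : Set (Act A) | Child DB η n n'}.Finite := by
  have hH : (⋃ r ∈ η, r.head).Finite := hη.biUnion fun r _ => r.head_finite
  refine ⟨hH.finite_subsets.subset fun n hn => ?_, fun n => ?_⟩
  · induction (hn : Relation.ReflTransGen (Child DB η) ∅ n) with
    | refl => exact Set.empty_subset _
    | tail h hc ih =>
      obtain ⟨_, r, hr, U, hU, _, rfl, _⟩ := hc
      exact Set.union_subset ih (hU.trans (Set.subset_biUnion_of_mem hr))
  · refine (hH.finite_subsets.image (n ∪ ·)).subset ?_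
    rintro _ ⟨_, r, hr, U, hU, _, rfl, _⟩
    exact ⟨U, hU.trans (Set.subset_biUnion_of_mem hr), rfl⟩

end AICs
end

section
/- Let η be a set of ground AICs over a database DB, let U be a grounded repair for ⟨DB, η⟩, and let V ⊊ U be any proper subset of U. Then there exist a constraint r ∈ η and an action α ∈ head(r) ∩ (U \ V) such that V(DB) ⊭ r and (V ∪ {α})(DB) ⊨ r. -/
namespace AICs
/-- if `U` is a grounded repair for `⟨DB, η⟩` and `V ⊊ U`, then
there are `r ∈ η` and `α ∈ head(r) ∩ (U \ V)` with `V(DB) ⊭ r` and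
`(V ∪ {α})(DB) ⊨ r`. -/
theorem stmt_7 {A : Type*} (DB : Set A) (η : Set (AIC A)) (U : Set (Act A))
    (hwr : WeakRepair DB η U) (hg : Grounded DB η U)
    (V : Set (Act A)) (hV : V ⊂ U) :
    ∃ r ∈ η, ∃ α ∈ r.head ∩ (U \ V),
      ¬ Sat (applyUpd V DB) r ∧ Sat (applyUpd (V ∪ {α}) DB) r := by
  obtain ⟨r, hr, hns, α, hα, hαU, hαV⟩ := hg V hV
  refine ⟨r, hr, α, ⟨hα, hαU, hαV⟩, hns, ?_⟩
  rintro ⟨hpos, hneg⟩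
  rcases r.head_sound α hα with ⟨a, ha, rfl⟩ | ⟨a, ha, rfl⟩
  · exact (hpos ha).2 (Or.inr rfl)
  · have hdel : Act.del a ∉ V ∪ {Act.add a} := by
      rintro (h | h)
      · exact hwr.2.1 a ⟨hαU, hV.subset h⟩
      · cases h
    have hmem : a ∈ r.neg ∩ applyUpd (V ∪ {Act.add a}) DB :=
      ⟨ha, Or.inr (Or.inr rfl), hdel⟩
    rw [hneg] at hmem
    exact hmem

end AICs
end

section
/- Let η be a finite set of ground AICs over a database DB. Then every grounded repair U for ⟨DB, η⟩ is a leaf of the repair tree T⟨DB,η⟩: U is reachable from the root ∅ via the repair-tree child relation, and U has no children (since U(DB) ⊨ η, no constraint of η is violated at U). -/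
namespace AICs

theorem Consistent.mono {A : Type*} {U V : Set (Act A)} (hU : Consistent U) (hVU : V ⊆ U) :
    Consistent V :=
  fun a h => hU a ⟨hVU h.1, hVU h.2⟩

/-- Adding to `V` a single head action of a violated constraint repairs that constraint. -/
theorem sat_applyUpd_union_singleton {A : Type*} {DB : Set A} {V : Set (Act A)} {r : AIC A}
    {α : Act A} (hα : α ∈ r.head) (hV : Consistent (V ∪ {α})) :
    Sat (applyUpd (V ∪ {α}) DB) r := by
  rintro ⟨hpos, hneg⟩
  rcases r.head_sound α hα with ⟨a, ha, rfl⟩ | ⟨a, ha, rfl⟩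
  · exact (hpos ha).2 (Or.inr rfl)
  · have hmem : a ∈ applyUpd (V ∪ {Act.add a}) DB :=
      ⟨Or.inr (Or.inr rfl), fun h => hV a ⟨Or.inr rfl, h⟩⟩
    exact Set.eq_empty_iff_forall_notMem.mp hneg a ⟨ha, hmem⟩

/-- Adding a single head action of a violated constraint is a step in the repair tree. -/
theorem child_union_singleton {A : Type*} {DB : Set A} {η : Set (AIC A)} {V : Set (Act A)}
    {r : AIC A} (hr : r ∈ η) (hviol : ¬ Sat (applyUpd V DB) r) {α : Act A} (hα : α ∈ r.head)
    (hV : Consistent (V ∪ {α})) : Child DB η V (V ∪ {α}) := by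
  refine ⟨hV.mono Set.subset_union_left, r, hr, {α}, Set.singleton_subset_iff.mpr hα, hviol, rfl,
    hV, sat_applyUpd_union_singleton hα hV, fun W hW => ?_⟩
  rwa [Set.ssubset_singleton_iff.mp hW, Set.union_empty]

/-- From every node below a grounded consistent finite set there is a path to that set. -/
theorem Grounded.reflTransGen_child {A : Type*} {DB : Set A} {η : Set (AIC A)}
    {U : Set (Act A)} (hg : Grounded DB η U) (hfin : U.Finite) (hU : Consistent U)
    {V : Set (Act A)} (hVU : V ⊆ U) : Relation.ReflTransGen (Child DB η) V U := by
  induction hn : (U \ V).ncard using Nat.strong_induction_on generalizing V with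
  | _ n ih =>
    rcases hVU.eq_or_ssubset with rfl | hss
    · exact .refl
    obtain ⟨r, hr, hviol, α, hα, hαU, hαV⟩ := hg V hss
    have hsub : V ∪ {α} ⊆ U := Set.union_subset hVU (Set.singleton_subset_iff.mpr hαU)
    have hlt : (U \ (V ∪ {α})).ncard < n := by
      rw [← hn]
      refine Set.ncard_lt_ncard ⟨Set.sdiff_subset_sdiff_right Set.subset_union_left, fun h => ?_⟩
        hfin.sdiff
      exact (h ⟨hαU, hαV⟩).2 (Or.inr rfl)
    exact .head (child_union_singleton hr hviol hα (hU.mono hsub)) (ih _ hlt hsub rfl)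

theorem SatSet.not_child {A : Type*} {DB : Set A} {η : Set (AIC A)} {U n' : Set (Act A)}
    (h : SatSet (applyUpd U DB) η) : ¬ Child DB η U n' :=
  fun ⟨_, r, hr, _, _, hviol, _⟩ => hviol (h r hr)

/-- every grounded repair for `⟨DB, η⟩` is a leaf of the repair
tree `T⟨DB,η⟩`: it is reachable from the root and has no children. -/
theorem stmt_8 {A : Type*} (DB : Set A) (η : Set (AIC A)) (hη : η.Finite)
    (U : Set (Act A)) (hwr : WeakRepair DB η U) (hg : Grounded DB η U) :
    Node DB η U ∧ ∀ n' : Set (Act A), ¬ Child DB η U n' := by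
  obtain ⟨hfin, hcons, _, _, hsat⟩ := hwr
  exact ⟨hg.reflTransGen_child hfin hcons (Set.empty_subset U), fun _ => hsat.not_child⟩

end AICs
end
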